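/- arXiv:2405.18169 — 2 statements merged into one kernel-verified Lean document; each statement's English description precedes it below -/
import Mathlib

section
/- Let d ≥ 3 and let S be a nonempty subset of vertices of the d-regular tree with root o. Let a_t(S) be the number of vertices of S at distance t from o and b_t(S) the number of walks of length t from o ending in S. Define α(S) = limsup a_t(S)^{1/t} and β(S) = limsup b_t(S)^{1/t}. Then β(S) = g_d(α(S)), where g_d(α) = 2√(d−1) if α ≤ √(d−1) and g_d(α) = α + (d−1)/α otherwise. -/
section WalkCounts

open Filter Topology

/-- The number of walks of length `t` in the `(q + 1)`-regular tree between two vertices at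
distance `k`. -/
def treeWalkCount (q : ℕ) : ℕ → ℕ → ℕ
  | 0, 0 => 1
  | 0, _ + 1 => 0
  | t + 1, 0 => (q + 1) * treeWalkCount q t 1
  | t + 1, k + 1 => treeWalkCount q t k + q * treeWalkCount q t (k + 2)

/-! ### Exponential growth rates -/

theorem isBoundedUnder_rpow_of_le {u : ℕ → ℝ} {C r : ℝ} (hu : ∀ t, 0 ≤ u t) (hr : 0 ≤ r)
    (h : ∀ t, u t ≤ C * r ^ t) :
    IsBoundedUnder (· ≤ ·) atTop fun t : ℕ => u t ^ ((1 : ℝ) / t) := by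
  refine isBoundedUnder_of_eventually_le (a := max C 1 * r) ?_
  filter_upwards [eventually_ge_atTop 1] with t ht
  have hC : 1 ≤ max C 1 := le_max_right _ _
  have ht0 : t ≠ 0 := by omega
  calc u t ^ ((1 : ℝ) / t) ≤ ((max C 1 * r) ^ t) ^ ((1 : ℝ) / t) := by
        refine Real.rpow_le_rpow (hu t) ((h t).trans ?_) (by positivity)
        rw [mul_pow]
        gcongr
        exact (le_max_left _ _).trans (le_self_pow₀ hC ht0)
    _ = max C 1 * r := by
        rw [one_div, Real.pow_rpow_inv_natCast (by positivity) ht0]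

theorem isCoboundedUnder_rpow {u : ℕ → ℝ} (hu : ∀ t, 0 ≤ u t) :
    IsCoboundedUnder (· ≤ ·) atTop fun t : ℕ => u t ^ ((1 : ℝ) / t) :=
  IsBoundedUnder.isCoboundedUnder_le
    (isBoundedUnder_of ⟨0, fun t => Real.rpow_nonneg (hu t) _⟩)

theorem limsup_rpow_nonneg {u : ℕ → ℝ} (hu : ∀ t, 0 ≤ u t)
    (hb : IsBoundedUnder (· ≤ ·) atTop fun t : ℕ => u t ^ ((1 : ℝ) / t)) :
    0 ≤ limsup (fun t : ℕ => u t ^ ((1 : ℝ) / t)) atTop :=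
  le_limsup_of_frequently_le (Frequently.of_forall fun t => Real.rpow_nonneg (hu t) _) hb

theorem eventually_le_pow_of_limsup_lt {u : ℕ → ℝ} {r : ℝ} (hu : ∀ t, 0 ≤ u t)
    (hb : IsBoundedUnder (· ≤ ·) atTop fun t : ℕ => u t ^ ((1 : ℝ) / t))
    (h : limsup (fun t : ℕ => u t ^ ((1 : ℝ) / t)) atTop < r) :
    ∀ᶠ t in atTop, u t ≤ r ^ t := by
  filter_upwards [eventually_lt_of_limsup_lt h hb, eventually_ge_atTop 1] with t ht ht1
  rw [one_div] at ht
  calc u t = (u t ^ ((t : ℝ)⁻¹)) ^ t := (Real.rpow_inv_natCast_pow (hu t) (by omega)).symm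
    _ ≤ r ^ t := pow_le_pow_left₀ (Real.rpow_nonneg (hu t) _) ht.le t

theorem summable_mul_pow_of_limsup_lt {u : ℕ → ℝ} {r : ℝ} (hu : ∀ t, 0 ≤ u t)
    (hb : IsBoundedUnder (· ≤ ·) atTop fun t : ℕ => u t ^ ((1 : ℝ) / t))
    (h : limsup (fun t : ℕ => u t ^ ((1 : ℝ) / t)) atTop < r) :
    Summable fun t => u t * r⁻¹ ^ t := by
  obtain ⟨s, hs, hsr⟩ := exists_between h
  have hs0 : 0 < s := (limsup_rpow_nonneg hu hb).trans_lt hs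
  have hr0 : 0 < r := hs0.trans hsr
  have hgeom : Summable fun t : ℕ => (s * r⁻¹) ^ t :=
    summable_geometric_of_lt_one (by positivity) (by
      rw [← div_eq_mul_inv]; exact (div_lt_one hr0).mpr hsr)
  refine Summable.of_norm_bounded_eventually_nat hgeom ?_
  filter_upwards [eventually_le_pow_of_limsup_lt hu hb hs] with t ht
  rw [Real.norm_of_nonneg (mul_nonneg (hu t) (by positivity)), mul_pow]
  gcongr

theorem limsup_rpow_le_of_le {u : ℕ → ℝ} {C r : ℝ} (hu : ∀ t, 0 ≤ u t) (hr : 0 ≤ r)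
    (h : ∀ t, u t ≤ C * r ^ t) :
    limsup (fun t : ℕ => u t ^ ((1 : ℝ) / t)) atTop ≤ r := by
  have hC : 1 ≤ max C 1 := le_max_right _ _
  have hlim : Tendsto (fun t : ℕ => max C 1 ^ ((1 : ℝ) / t) * r) atTop (𝓝 r) := by
    have := (tendsto_const_nhds (x := max C 1)).rpow
      (tendsto_one_div_atTop_nhds_zero_nat (𝕜 := ℝ)) (Or.inl (by positivity))
    simpa using this.mul_const r
  rw [← hlim.limsup_eq]
  refine limsup_le_limsup ?_ (isCoboundedUnder_rpow hu) hlim.isBoundedUnder_le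
  filter_upwards [eventually_ge_atTop 1] with t ht
  calc u t ^ ((1 : ℝ) / t) ≤ (max C 1 * r ^ t) ^ ((1 : ℝ) / t) := by
        refine Real.rpow_le_rpow (hu t) ((h t).trans ?_) (by positivity)
        gcongr
        exact le_max_left _ _
    _ = max C 1 ^ ((1 : ℝ) / t) * r := by
        rw [Real.mul_rpow (by positivity) (by positivity), one_div,
          Real.pow_rpow_inv_natCast hr (by omega)]

/-! ### Walk counts in the regular tree -/

theorem treeWalkCount_le (q : ℕ) {x : ℝ} (hx : 1 ≤ x) (t k : ℕ) :
    (treeWalkCount q t k : ℝ) ≤ (x + q / x) ^ t * x⁻¹ ^ k := by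
  have hx0 : 0 < x := by positivity
  induction t generalizing k with
  | zero =>
    cases k with
    | zero => simp [treeWalkCount]
    | succ k => simp only [treeWalkCount]; push_cast; positivity
  | succ t ih =>
    cases k with
    | zero =>
      simp only [treeWalkCount]
      push_cast
      calc ((q : ℝ) + 1) * treeWalkCount q t 1 ≤ (q + 1) * ((x + q / x) ^ t * x⁻¹ ^ 1) := by
            gcongr; exact ih 1
        _ = (x + q / x) ^ t * (x⁻¹ + q / x) := by ring
        _ ≤ (x + q / x) ^ t * (x + q / x) := by
            gcongr; exact (inv_le_one_of_one_le₀ hx).trans hx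
        _ = (x + q / x) ^ (t + 1) * x⁻¹ ^ 0 := by ring
    | succ k =>
      simp only [treeWalkCount]
      push_cast
      calc (treeWalkCount q t k : ℝ) + q * treeWalkCount q t (k + 2)
          ≤ (x + q / x) ^ t * x⁻¹ ^ k + q * ((x + q / x) ^ t * x⁻¹ ^ (k + 2)) := by
            gcongr
            · exact ih k
            · exact ih (k + 2)
        _ = (x + q / x) ^ (t + 1) * x⁻¹ ^ (k + 1) := by
            rw [pow_succ (x + q / x), pow_succ x⁻¹, pow_add]
            field_simp

theorem treeWalkCount_eq_zero_of_lt (q : ℕ) {t k : ℕ} (h : t < k) : treeWalkCount q t k = 0 := by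
  induction t generalizing k with
  | zero =>
    obtain ⟨k, rfl⟩ := Nat.exists_eq_succ_of_ne_zero h.ne'
    simp [treeWalkCount]
  | succ t ih =>
    obtain ⟨k, rfl⟩ := Nat.exists_eq_succ_of_ne_zero (Nat.ne_zero_of_lt h)
    simp [treeWalkCount, ih (show t < k by omega), ih (show t < k + 2 by omega)]

theorem treeWalkCount_self_pos (q k : ℕ) : 0 < treeWalkCount q k k := by
  induction k with
  | zero => simp [treeWalkCount]
  | succ k ih => simp only [treeWalkCount]; omega

theorem treeWalkCount_le_succ_succ (q t k : ℕ) :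
    treeWalkCount q t k ≤ treeWalkCount q (t + 1) (k + 1) := by
  simp only [treeWalkCount]; omega

theorem treeWalkCount_succ_le_succ {q : ℕ} (hq : 1 ≤ q) (t k : ℕ) :
    treeWalkCount q t (k + 1) ≤ treeWalkCount q (t + 1) k := by
  cases k with
  | zero => simp only [treeWalkCount]; nlinarith
  | succ k => simp only [treeWalkCount]; nlinarith

/-- The Green function of the `(q + 1)`-regular tree, as a function of the distance. -/
noncomputable def treeGreen (q : ℕ) (z : ℝ) (k : ℕ) : ℝ :=
  ∑' t, (treeWalkCount q t k : ℝ) * z ^ t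

theorem treeGreen_succ {q : ℕ} {z : ℝ}
    (hs : ∀ k, Summable fun t => (treeWalkCount q t k : ℝ) * z ^ t) (k : ℕ) :
    treeGreen q z (k + 1) = z * (treeGreen q z k + q * treeGreen q z (k + 2)) := by
  rw [treeGreen, (hs (k + 1)).tsum_eq_zero_add, treeGreen, treeGreen, ← tsum_mul_left,
    ← (hs k).tsum_add ((hs (k + 2)).mul_left _), ← tsum_mul_left]
  simp only [treeWalkCount, Nat.cast_zero, zero_mul, zero_add]
  congr 1
  ext t
  push_cast
  ring

theorem treeGreen_pos {q : ℕ} {z : ℝ} (hz : 0 < z)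
    (hs : ∀ k, Summable fun t => (treeWalkCount q t k : ℝ) * z ^ t) (k : ℕ) :
    0 < treeGreen q z k :=
  (hs k).tsum_pos (fun t => by positivity) k
    (mul_pos (Nat.cast_pos.mpr (treeWalkCount_self_pos q k)) (by positivity))

theorem one_le_treeGreen_zero {q : ℕ} {z : ℝ} (hz : 0 < z)
    (hs : Summable fun t => (treeWalkCount q t 0 : ℝ) * z ^ t) : 1 ≤ treeGreen q z 0 := by
  have := hs.le_tsum 0 fun t _ => by positivity
  simpa [treeWalkCount, treeGreen] using this

theorem two_mul_sqrt_lt_add_div {q : ℕ} (hq : 1 ≤ q) {x : ℝ} (hx : √q < x) :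
    2 * √q < x + q / x := by
  have hs0 : 0 < √(q : ℝ) := Real.sqrt_pos.mpr (by exact_mod_cast hq)
  have hx0 : 0 < x := hs0.trans hx
  have hsq : √(q : ℝ) ^ 2 = q := Real.sq_sqrt (by positivity)
  have : x + q / x - 2 * √q = (x - √q) ^ 2 / x := by
    rw [eq_div_iff hx0.ne', sub_mul, add_mul, div_mul_cancel₀ _ hx0.ne']
    linear_combination -hsq
  have h2 : 0 < (x - √q) ^ 2 / x := div_pos (pow_pos (sub_pos.mpr hx) 2) hx0
  linarith

theorem treeWalkCount_mul_pow_le {q : ℕ} (hq : 1 ≤ q) {z : ℝ} (hz : 0 ≤ z) (t k : ℕ) :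
    (treeWalkCount q t k : ℝ) * z ^ t ≤ (√q)⁻¹ ^ k * (2 * √q * z) ^ t := by
  have h := treeWalkCount_le q (x := √q) (Real.one_le_sqrt.mpr (by exact_mod_cast hq)) t k
  rw [Real.div_sqrt, ← two_mul] at h
  rw [mul_pow _ z, ← mul_assoc, mul_comm _ ((2 * √(q : ℝ)) ^ t)]
  gcongr

theorem summable_two_mul_sqrt_mul_pow {q : ℕ} {r : ℝ} (hr : 2 * √q < r) :
    Summable fun t : ℕ => (2 * √q * r⁻¹) ^ t := by
  have hr0 : 0 < r := lt_of_le_of_lt (by positivity) hr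
  refine summable_geometric_of_lt_one (by positivity) ?_
  rw [← div_eq_mul_inv]
  exact (div_lt_one hr0).mpr hr

theorem summable_treeWalkCount {q : ℕ} (hq : 1 ≤ q) {r : ℝ} (hr : 2 * √q < r) (k : ℕ) :
    Summable fun t => (treeWalkCount q t k : ℝ) * r⁻¹ ^ t := by
  have hr0 : 0 < r := lt_of_le_of_lt (by positivity) hr
  exact Summable.of_nonneg_of_le (fun t => by positivity)
    (fun t => treeWalkCount_mul_pow_le hq (by positivity) t k)
    ((summable_two_mul_sqrt_mul_pow hr).mul_left _)

/-- Above the spectral radius the Green function decays no faster than `x⁻¹ ^ k`. -/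
theorem inv_pow_le_treeGreen {q : ℕ} (hq : 1 ≤ q) {x : ℝ} (hx : √q < x) (k : ℕ) :
    x⁻¹ ^ k ≤ treeGreen q (x + q / x)⁻¹ k := by
  have hq0 : (0 : ℝ) < q := by exact_mod_cast hq
  have hs0 : 0 < √(q : ℝ) := Real.sqrt_pos.mpr hq0
  have hx0 : 0 < x := hs0.trans hx
  have hsq : √(q : ℝ) * √q = q := Real.mul_self_sqrt hq0.le
  have hr := two_mul_sqrt_lt_add_div hq hx
  have hs := summable_treeWalkCount hq hr
  have hr0 : 0 < x + q / x := by positivity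
  have hrec := treeGreen_succ hs
  set g := treeGreen q (x + q / x)⁻¹ with hg
  have hgpos : ∀ k, 0 < g k := treeGreen_pos (inv_pos.mpr hr0) hs
  obtain ⟨C, hC⟩ : ∃ C, ∀ k, g k ≤ (√q)⁻¹ ^ k * C := by
    refine ⟨∑' t : ℕ, (2 * √q * (x + q / x)⁻¹) ^ t, fun k => ?_⟩
    rw [← tsum_mul_left]
    exact (hs k).tsum_le_tsum (fun t => treeWalkCount_mul_pow_le hq (by positivity) t k)
      ((summable_two_mul_sqrt_mul_pow hr).mul_left _)
  have hD : ∀ k, g (k + 1) - g k / x = (x / q) ^ k * (g 1 - g 0 / x) := by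
    intro k
    induction k with
    | zero => simp
    | succ k ih =>
      rw [pow_succ', mul_assoc, ← ih]
      have h := hrec k
      rw [eq_inv_mul_iff_mul_eq₀ hr0.ne'] at h
      field_simp at h ⊢
      linear_combination -h
  have hD0 : 0 ≤ g 1 - g 0 / x := by
    by_contra! hneg
    obtain ⟨k, hk⟩ := pow_unbounded_of_one_lt (C / x / -(g 1 - g 0 / x))
      ((one_lt_div hs0).mpr hx)
    rw [div_lt_iff₀ (neg_pos.mpr hneg)] at hk
    have h1 := hD k
    have h2 : -((√q)⁻¹ ^ k * C / x) ≤ g (k + 1) - g k / x := by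
      have := hgpos (k + 1)
      have := div_le_div_of_nonneg_right (hC k) hx0.le
      linarith
    rw [h1] at h2
    have h3 := mul_le_mul_of_nonneg_left h2 (pow_nonneg hs0.le k)
    have e1 : √(q : ℝ) ^ k * -((√q)⁻¹ ^ k * C / x) = -(C / x) := by
      rw [inv_pow]
      field_simp
    have e2 : √(q : ℝ) ^ k * ((x / q) ^ k * (g 1 - g 0 / x)) =
        (x / √q) ^ k * (g 1 - g 0 / x) := by
      rw [← mul_assoc, ← mul_pow]
      congr 2
      rw [mul_div_assoc', div_eq_div_iff hq0.ne' hs0.ne']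
      linear_combination x * hsq
    rw [e1, e2] at h3
    linarith
  induction k with
  | zero => simpa using one_le_treeGreen_zero (inv_pos.mpr hr0) (hs 0)
  | succ k ih =>
    have h1 := hD k
    have h2 : 0 ≤ (x / q) ^ k * (g 1 - g 0 / x) := by positivity
    calc x⁻¹ ^ (k + 1) = x⁻¹ ^ k / x := by rw [pow_succ, div_eq_mul_inv]
      _ ≤ g k / x := by gcongr
      _ ≤ g (k + 1) := by linarith

/-- Below the spectral radius the Green function diverges. -/
theorem not_summable_treeWalkCount {q : ℕ} (hq : 1 ≤ q) {r : ℝ} (hr0 : 0 < r) (hr : r < 2 * √q)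
    (k : ℕ) : ¬ Summable fun t => (treeWalkCount q t k : ℝ) * r⁻¹ ^ t := by
  intro hk
  have hq0 : (0 : ℝ) < q := by exact_mod_cast hq
  have hs0 : 0 < √(q : ℝ) := Real.sqrt_pos.mpr hq0
  have hsq : √(q : ℝ) ^ 2 = q := Real.sq_sqrt hq0.le
  have hstep : ∀ i j, (∀ t, treeWalkCount q t j ≤ treeWalkCount q (t + 1) i) →
      (Summable fun t => (treeWalkCount q t i : ℝ) * r⁻¹ ^ t) →
      Summable fun t => (treeWalkCount q t j : ℝ) * r⁻¹ ^ t := by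
    intro i j hij hi
    refine Summable.of_nonneg_of_le (fun t => by positivity) (fun t => ?_)
      (((summable_nat_add_iff 1).mpr hi).mul_left r)
    have : (treeWalkCount q t j : ℝ) ≤ treeWalkCount q (t + 1) i := by exact_mod_cast hij t
    calc (treeWalkCount q t j : ℝ) * r⁻¹ ^ t ≤ treeWalkCount q (t + 1) i * r⁻¹ ^ t := by gcongr
      _ = r * (treeWalkCount q (t + 1) i * r⁻¹ ^ (t + 1)) := by
        rw [pow_succ]
        field_simp
  have h0 : Summable fun t => (treeWalkCount q t 0 : ℝ) * r⁻¹ ^ t := by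
    induction k with
    | zero => exact hk
    | succ k ih => exact ih (hstep _ _ (fun t => treeWalkCount_le_succ_succ q t k) hk)
  have hs : ∀ k, Summable fun t => (treeWalkCount q t k : ℝ) * r⁻¹ ^ t := by
    intro k
    induction k with
    | zero => exact h0
    | succ k ih => exact hstep _ _ (fun t => treeWalkCount_succ_le_succ hq t k) ih
  have hrec := treeGreen_succ hs
  have hgpos := treeGreen_pos (inv_pos.mpr hr0) hs
  set g := treeGreen q r⁻¹
  have hdecr : ∀ k, g (k + 2) / g (k + 1) ≤ g (k + 1) / g k - (2 * √q - r) / q := by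
    intro k
    have ha := hgpos k
    have hb := hgpos (k + 1)
    have h := hrec k
    rw [eq_inv_mul_iff_mul_eq₀ hr0.ne'] at h
    have hc : g (k + 2) = (r * g (k + 1) - g k) / q := by
      rw [eq_div_iff hq0.ne']; linarith
    rw [hc, ← sub_nonneg]
    have : g (k + 1) / g k - (2 * √q - r) / q - (r * g (k + 1) - g k) / q / g (k + 1) =
        (√q * g (k + 1) - g k) ^ 2 / (q * g k * g (k + 1)) := by
      field_simp
      linear_combination (-g (k + 1) ^ 2) * hsq
    rw [this]
    positivity
  have hlin : ∀ k : ℕ, g (k + 1) / g k ≤ g 1 / g 0 - k * ((2 * √q - r) / q) := by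
    intro k
    induction k with
    | zero => simp
    | succ k ih =>
      have := hdecr k
      push_cast
      linarith
  have hδ : 0 < (2 * √q - r) / q := div_pos (by linarith) hq0
  obtain ⟨n, hn⟩ := exists_nat_gt (g 1 / g 0 / ((2 * √q - r) / q))
  rw [div_lt_iff₀ hδ] at hn
  have h1 := hlin n
  have h2 := div_pos (hgpos (n + 1)) (hgpos n)
  linarith

/-- The analytic form of the extended cogrowth formula: the growth rate of
`∑ k ≤ t, a k * treeWalkCount q t k` in terms of the growth rate of `a`. -/
theorem limsup_sum_mul_treeWalkCount {q : ℕ} (hq : 1 ≤ q) {a : ℕ → ℕ} {M : ℕ}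
    (ha : ∀ k, a k ≤ M ^ k) {k₀ : ℕ} (hk₀ : a k₀ ≠ 0) {b : ℕ → ℕ}
    (hb : ∀ t, b t = ∑ k ∈ Finset.range (t + 1), a k * treeWalkCount q t k) {α : ℝ}
    (hα : α = limsup (fun t : ℕ => (a t : ℝ) ^ ((1 : ℝ) / t)) atTop) :
    limsup (fun t : ℕ => (b t : ℝ) ^ ((1 : ℝ) / t)) atTop =
      if α ≤ √q then 2 * √q else α + q / α := by
  have hq0 : (0 : ℝ) < q := by exact_mod_cast hq
  have hs0 : 0 < √(q : ℝ) := Real.sqrt_pos.mpr hq0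
  have ha0 : ∀ t, (0 : ℝ) ≤ a t := fun t => by positivity
  have hb0 : ∀ t, (0 : ℝ) ≤ b t := fun t => by positivity
  have habdd := isBoundedUnder_rpow_of_le (u := fun t => (a t : ℝ)) (C := 1) (r := M) ha0
    (by positivity) fun t => by rw [one_mul]; exact_mod_cast ha t
  have hα0 : 0 ≤ α := hα ▸ limsup_rpow_nonneg ha0 habdd
  have hble : ∀ x : ℝ, √q ≤ x → α < x → ∃ C, ∀ t, (b t : ℝ) ≤ C * (x + q / x) ^ t := by
    intro x hx hαx
    have hx0 : 0 < x := hs0.trans_le hx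
    have hsum := summable_mul_pow_of_limsup_lt ha0 habdd (hα ▸ hαx)
    refine ⟨∑' k, (a k : ℝ) * x⁻¹ ^ k, fun t => ?_⟩
    rw [hb]
    push_cast
    calc ∑ k ∈ Finset.range (t + 1), (a k : ℝ) * treeWalkCount q t k
        ≤ ∑ k ∈ Finset.range (t + 1), (a k : ℝ) * x⁻¹ ^ k * (x + q / x) ^ t := by
          refine Finset.sum_le_sum fun k _ => ?_
          rw [mul_assoc, mul_comm (x⁻¹ ^ k)]
          gcongr
          refine treeWalkCount_le q (le_trans ?_ hx) t k
          exact Real.one_le_sqrt.mpr (by exact_mod_cast hq)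
      _ = (∑ k ∈ Finset.range (t + 1), (a k : ℝ) * x⁻¹ ^ k) * (x + q / x) ^ t := by
          rw [Finset.sum_mul]
      _ ≤ _ := by
          gcongr
          exact hsum.sum_le_tsum _ fun k _ => by positivity
  have hbbdd : IsBoundedUnder (· ≤ ·) atTop fun t : ℕ => (b t : ℝ) ^ ((1 : ℝ) / t) := by
    have hx0 : 0 < α + √q + 1 := by positivity
    obtain ⟨C, hC⟩ := hble (α + √q + 1) (by linarith) (by linarith)
    exact isBoundedUnder_rpow_of_le hb0 (by positivity) hC
  set β := limsup (fun t : ℕ => (b t : ℝ) ^ ((1 : ℝ) / t)) atTop with hβ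
  have hβ0 : 0 ≤ β := limsup_rpow_nonneg hb0 hbbdd
  have hab : ∀ k t, (a k : ℝ) * treeWalkCount q t k ≤ b t := by
    intro k t
    rcases lt_or_ge t k with hkt | hkt
    · simp [treeWalkCount_eq_zero_of_lt q hkt]
    · have := Finset.single_le_sum (f := fun k => a k * treeWalkCount q t k)
        (fun i _ => Nat.zero_le _) (Finset.mem_range.mpr (by omega : k < t + 1))
      rw [hb]
      exact_mod_cast this
  have hcont : ∀ m : ℝ, 0 < m → ContinuousAt (fun x : ℝ => x + q / x) m := fun m hm =>
    continuousAt_id.add (continuousAt_const.div continuousAt_id hm.ne')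
  have hupper : ∀ m : ℝ, √q ≤ m → α ≤ m → β ≤ m + q / m := by
    intro m hm hαm
    refine ge_of_tendsto ((hcont m (hs0.trans_le hm)).tendsto.mono_left
      (nhdsWithin_le_nhds (s := Set.Ioi m))) ?_
    filter_upwards [self_mem_nhdsWithin] with x hx
    have hx0 : 0 < x := (hs0.trans_le hm).trans hx
    obtain ⟨C, hC⟩ := hble x (hm.trans (le_of_lt hx)) (hαm.trans_lt hx)
    exact limsup_rpow_le_of_le hb0 (by positivity) hC
  split_ifs with h
  · apply le_antisymm
    · have := hupper √q le_rfl h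
      rwa [Real.div_sqrt, ← two_mul] at this
    · by_contra! hlt
      obtain ⟨r, hβr, hr⟩ := exists_between hlt
      have hr0 : 0 < r := hβ0.trans_lt hβr
      refine not_summable_treeWalkCount hq hr0 hr k₀ ?_
      refine Summable.of_nonneg_of_le (fun t => by positivity) (fun t => ?_)
        (summable_mul_pow_of_limsup_lt hb0 hbbdd hβr)
      have h1 : (1 : ℝ) ≤ a k₀ := by exact_mod_cast Nat.one_le_iff_ne_zero.mpr hk₀
      refine mul_le_mul_of_nonneg_right ?_ (by positivity)
      exact (le_mul_of_one_le_left (by positivity) h1).trans (hab k₀ t)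
  · push Not at h
    apply le_antisymm (hupper α h.le le_rfl)
    by_contra! hlt
    have hα1 : 0 < α := hs0.trans h
    obtain ⟨x, hβx, hsx, hxα⟩ : ∃ x, β < x + q / x ∧ √q < x ∧ x < α := by
      have h1 : ∀ᶠ x in 𝓝[<] α, β < x + q / x :=
        ((hcont α hα1).tendsto.mono_left nhdsWithin_le_nhds).eventually_const_lt hlt
      have h2 : ∀ᶠ x in 𝓝[<] α, √q < x :=
        (eventually_gt_nhds h).filter_mono nhdsWithin_le_nhds
      exact (h1.and (h2.and self_mem_nhdsWithin)).exists
    have hx0 : 0 < x := hs0.trans hsx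
    have hsum := summable_mul_pow_of_limsup_lt hb0 hbbdd hβx
    refine hxα.not_ge (hα ▸ limsup_rpow_le_of_le (C := ∑' t, (b t : ℝ) * (x + q / x)⁻¹ ^ t)
      ha0 hx0.le fun k => ?_)
    have hgreen := summable_treeWalkCount hq (two_mul_sqrt_lt_add_div hq hsx) k
    have h1 : (a k : ℝ) * x⁻¹ ^ k ≤ ∑' t, (b t : ℝ) * (x + q / x)⁻¹ ^ t := by
      refine (mul_le_mul_of_nonneg_left (inv_pow_le_treeGreen hq hsx k) (ha0 k)).trans ?_
      rw [treeGreen, ← tsum_mul_left]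
      refine (hgreen.mul_left _).tsum_le_tsum (fun t => ?_) hsum
      rw [← mul_assoc]
      gcongr
      exact hab k t
    rwa [inv_pow, ← div_eq_mul_inv, div_le_iff₀ (by positivity)] at h1

end WalkCounts

/-! ### Walks in regular trees -/

namespace SimpleGraph

variable {V : Type*} {G : SimpleGraph V}

/-- In a tree, each `u ≠ v` has exactly one neighbor closer to `v`. -/
theorem IsTree.exists_adj_dist_eq (hG : G.IsTree) {u v : V} {k : ℕ}
    (hk : G.dist u v = k + 1) :
    ∃ w, G.Adj u w ∧ G.dist w v = k ∧ ∀ w', G.Adj u w' → w' ≠ w → G.dist w' v = k + 2 := by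
  obtain ⟨p, hp, hpl⟩ := hG.connected.exists_path_of_dist u v
  have hnil : ¬ p.Nil := by
    intro h
    have := Walk.length_eq_zero_iff.mpr h
    omega
  have key : ∀ w, G.Adj u w → G.dist w v = k ∨ G.dist w v = k + 2 := by
    intro w hw
    have := hG.dist_eq_dist_add_one_of_adj v hw
    rw [dist_comm (u := v) (v := u), dist_comm (u := v) (v := w)] at this
    omega
  refine ⟨p.snd, p.adj_snd hnil, ?_, ?_⟩
  · have h1 := dist_le p.tail
    have h2 := Walk.length_tail_add_one hnil
    rcases key _ (p.adj_snd hnil) with h | h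
    · exact h
    · omega
  · intro w' hw' hne
    refine (key w' hw').resolve_left fun hd => hne ?_
    obtain ⟨r, hr, hrl⟩ := hG.connected.exists_path_of_dist w' v
    have hc : (Walk.cons hw' r).IsPath := by
      apply Walk.isPath_of_length_eq_dist
      rw [Walk.length_cons]
      omega
    have := hG.isAcyclic.subsingleton_path u v
    have h3 : p = Walk.cons hw' r :=
      congrArg Subtype.val (Subsingleton.elim (⟨p, hp⟩ : G.Path u v) ⟨_, hc⟩)
    rw [h3]
    simp

theorem IsTree.card_walk_length_eq [G.LocallyFinite] (hG : G.IsTree) {q : ℕ}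
    (hreg : G.IsRegularOfDegree (q + 1)) (t : ℕ) (u v : V) :
    Nat.card {p : G.Walk u v // p.length = t} = treeWalkCount q t (G.dist u v) := by
  classical
  have hcard : ∀ t u, Nat.card {p : G.Walk u v // p.length = t} =
      (G.finsetWalkLength t u v).card := by
    intro t u
    rw [← card_set_walk_length_eq, ← Nat.card_eq_fintype_card]
    rfl
  rw [hcard]
  induction t generalizing u with
  | zero =>
    by_cases h : u = v
    · subst h
      simp [finsetWalkLength, treeWalkCount]
    · obtain ⟨k, hk⟩ := Nat.exists_eq_succ_of_ne_zero (hG.connected.pos_dist_of_ne h).ne'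
      simp [finsetWalkLength, hk, treeWalkCount, h]
  | succ t ih =>
    have hrec : (G.finsetWalkLength (t + 1) u v).card =
        ∑ w ∈ G.neighborFinset u, treeWalkCount q t (G.dist w v) := by
      rw [finsetWalkLength, Finset.card_biUnion]
      · simp only [Finset.card_map, ih, neighborFinset_def]
        exact (Finset.sum_subtype _ (fun w => Set.mem_toFinset)
          fun w => treeWalkCount q t (G.dist w v)).symm
      · rintro ⟨x, hx⟩ - ⟨y, hy⟩ - hxy
        rw [Function.onFun, Finset.disjoint_left]
        intro p hp hp'
        simp only [Finset.mem_map] at hp hp'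
        obtain ⟨px, -, rfl⟩ := hp
        obtain ⟨py, -, hp⟩ := hp'
        cases hp
        simp at hxy
    rw [hrec]
    have hdeg : (G.neighborFinset u).card = q + 1 := hreg u
    by_cases h : u = v
    · subst h
      rw [Finset.sum_congr rfl (g := fun _ => treeWalkCount q t 1)]
      · simp [hdeg, treeWalkCount]
      · intro w hw
        rw [mem_neighborFinset] at hw
        rw [dist_eq_one_iff_adj.mpr hw.symm]
    · obtain ⟨k, hk⟩ := Nat.exists_eq_succ_of_ne_zero (hG.connected.pos_dist_of_ne h).ne'
      obtain ⟨w, hw, hwk, hw'⟩ := hG.exists_adj_dist_eq hk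
      have hmem : w ∈ G.neighborFinset u := by simpa using hw
      rw [← Finset.add_sum_erase _ _ hmem, hwk, hk,
        Finset.sum_congr rfl (g := fun _ => treeWalkCount q t (k + 2))]
      · simp [hdeg, treeWalkCount, Finset.card_erase_of_mem hmem]
      · intro x hx
        simp only [Finset.mem_erase, mem_neighborFinset] at hx
        rw [hw' x hx.2 hx.1]

theorem IsTree.exists_finset_sphere [G.LocallyFinite] (hG : G.IsTree) {d : ℕ}
    (hreg : G.IsRegularOfDegree d) (o : V) (k : ℕ) :
    ∃ s : Finset V, s.card ≤ d ^ k ∧ ∀ v, G.dist o v = k → v ∈ s := by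
  classical
  induction k with
  | zero =>
    refine ⟨{o}, by simp, fun v hv => ?_⟩
    simpa [hG.connected.dist_eq_zero_iff, eq_comm] using hv
  | succ k ih =>
    obtain ⟨s, hs, hmem⟩ := ih
    refine ⟨s.biUnion fun w => G.neighborFinset w, ?_, fun v hv => ?_⟩
    · refine (Finset.card_biUnion_le_card_mul _ _ d fun x _ => (hreg x).le).trans ?_
      rw [pow_succ]
      gcongr
    · rw [dist_comm] at hv
      obtain ⟨w, hw, hwk, -⟩ := hG.exists_adj_dist_eq hv
      rw [dist_comm] at hwk
      exact Finset.mem_biUnion.mpr ⟨w, hmem w hwk, by simpa using hw.symm⟩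

theorem IsTree.finite_sphere [G.LocallyFinite] (hG : G.IsTree) {d : ℕ}
    (hreg : G.IsRegularOfDegree d) (o : V) (S : Set V) (k : ℕ) :
    Finite {v : V // v ∈ S ∧ G.dist o v = k} := by
  obtain ⟨s, -, hs⟩ := hG.exists_finset_sphere hreg o k
  exact (s.finite_toSet.subset fun v (hv : v ∈ S ∧ G.dist o v = k) => hs v hv.2).to_subtype

theorem IsTree.card_sphere_le [G.LocallyFinite] (hG : G.IsTree) {d : ℕ}
    (hreg : G.IsRegularOfDegree d) (o : V) (S : Set V) (k : ℕ) :
    Nat.card {v : V // v ∈ S ∧ G.dist o v = k} ≤ d ^ k := by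
  obtain ⟨s, hsc, hs⟩ := hG.exists_finset_sphere hreg o k
  refine le_trans ?_ hsc
  rw [← Nat.card_eq_finsetCard]
  exact Nat.card_le_card_of_injective
    (fun v : {v : V // v ∈ S ∧ G.dist o v = k} => (⟨v.1, hs _ v.2.2⟩ : s))
    fun _ _ h => Subtype.ext (congrArg Subtype.val h :)

theorem IsTree.card_walk_ending_in [G.LocallyFinite] (hG : G.IsTree) {q : ℕ}
    (hreg : G.IsRegularOfDegree (q + 1)) (o : V) (S : Set V) (t : ℕ) :
    Nat.card {p : Σ v : V, G.Walk o v // p.2.length = t ∧ p.1 ∈ S} =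
      ∑ k ∈ Finset.range (t + 1),
        Nat.card {v : V // v ∈ S ∧ G.dist o v = k} * treeWalkCount q t k := by
  classical
  have hfin := hG.finite_sphere hreg o S
  have e : {p : Σ v : V, G.Walk o v // p.2.length = t ∧ p.1 ∈ S} ≃
      Σ k : Fin (t + 1), Σ v : {v : V // v ∈ S ∧ G.dist o v = k},
        {p : G.Walk o v // p.length = t} :=
    { toFun := fun p => ⟨⟨G.dist o p.1.1, by have := dist_le p.1.2; have := p.2.1; omega⟩,
        ⟨p.1.1, p.2.2, rfl⟩, ⟨p.1.2, p.2.1⟩⟩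
      invFun := fun x => ⟨⟨x.2.1.1, x.2.2.1⟩, x.2.2.2, x.2.1.2.1⟩
      left_inv := fun p => rfl
      right_inv := by
        rintro ⟨⟨k, hk⟩, ⟨v, hv, h⟩, p, hp⟩
        dsimp only at h
        subst h
        rfl }
  have hwf : ∀ v, Finite {p : G.Walk o v // p.length = t} := fun v =>
    inferInstanceAs (Finite {p : G.Walk o v | p.length = t})
  have (k : Fin (t + 1)) : Fintype {v : V // v ∈ S ∧ G.dist o v = k} := Fintype.ofFinite _
  rw [Nat.card_congr e, Nat.card_sigma, Finset.sum_range]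
  refine Finset.sum_congr rfl fun k _ => ?_
  rw [Nat.card_sigma, Finset.sum_congr rfl (g := fun _ => treeWalkCount q t k)]
  · simp
  · rintro ⟨v, hv, hk⟩ -
    rw [hG.card_walk_length_eq hreg, hk]

end SimpleGraph


/-- Extended cogrowth formula for subsets of the `d`-regular tree: if `a_t(S)` is the number
of vertices of `S` at distance `t` from the root `o`, `b_t(S)` is the number of walks of
length `t` from `o` ending in `S`, `α(S) = limsup a_t(S)^{1/t}` and
`β(S) = limsup b_t(S)^{1/t}`, then `β(S) = g_d(α(S))`. -/
theorem extended_cogrowth_formula (d : ℕ) (hd : 3 ≤ d) {V : Type*} (G : SimpleGraph V)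
    [G.LocallyFinite] (hreg : G.IsRegularOfDegree d) (hconn : G.Connected)
    (hacyc : G.IsAcyclic) (o : V) (S : Set V) (hS : S.Nonempty) :
    ∀ α : ℝ,
      α = Filter.limsup
          (fun t : ℕ =>
            ((Nat.card {v : V // v ∈ S ∧ G.dist o v = t} : ℝ)) ^ ((1 : ℝ) / t))
          Filter.atTop →
      Filter.limsup
          (fun t : ℕ =>
            ((Nat.card {q : Σ v : V, G.Walk o v // q.2.length = t ∧ q.1 ∈ S} : ℝ)) ^
              ((1 : ℝ) / t))
          Filter.atTop =
        (if α ≤ Real.sqrt ((d : ℝ) - 1) then 2 * Real.sqrt ((d : ℝ) - 1)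
         else α + ((d : ℝ) - 1) / α) := by
  intro α hα
  obtain ⟨q, rfl⟩ : ∃ q, d = q + 1 := ⟨d - 1, by omega⟩
  have hG : G.IsTree := ⟨hconn, hacyc⟩
  obtain ⟨v, hv⟩ := hS
  have hcast : ((q + 1 : ℕ) : ℝ) - 1 = q := by push_cast; ring
  rw [hcast]
  have := hG.finite_sphere hreg o S (G.dist o v)
  have : Nonempty {w : V // w ∈ S ∧ G.dist o w = G.dist o v} := ⟨⟨v, hv, rfl⟩⟩
  exact limsup_sum_mul_treeWalkCount (by omega) (hG.card_sphere_le hreg o S)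
    (k₀ := G.dist o v) Nat.card_pos.ne' (hG.card_walk_ending_in hreg o S) hα
end

section
/- Let d ≥ 3 and f : V(T_d) → ℝ_{≥0}. If the ordinary limit ᾱ = lim_{t→∞} a_{2t}(f)^{1/(2t)} exists and f is not identically zero on vertices at even distance from o, then lim_{t→∞} b_{2t}(f)^{1/(2t)} exists and equals g_d(ᾱ). -/
namespace SimpleGraph

theorem IsAcyclic.length_eq_dist_of_isPath {V : Type*} {G : SimpleGraph V}
    (hacyc : G.IsAcyclic) {u v : V} {p : G.Walk u v}
    (hp : p.IsPath) : p.length = G.dist u v := by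
  obtain ⟨q, hq, hlen⟩ := p.reachable.exists_path_of_dist
  have := congrArg Subtype.val ((hacyc.subsingleton_path _ _).elim ⟨p, hp⟩ ⟨q, hq⟩)
  simp only at this
  rw [this, hlen]

section WalkSums

variable {V : Type*} (G : SimpleGraph V)

/-- The walks of length `t` starting at `o`, with arbitrary endpoint. -/
abbrev WalksFrom (o : V) (t : ℕ) : Type _ := {q : Σ v : V, G.Walk o v // q.2.length = t}

/-- A walk of length `t + 1` is a first step followed by a walk of length `t`. -/
noncomputable def walksFromSuccEquiv (o : V) (t : ℕ) :
    (Σ u : G.neighborSet o, G.WalksFrom u t) ≃ G.WalksFrom o (t + 1) :=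
  Equiv.ofBijective
    (fun x => ⟨⟨x.2.1.1, Walk.cons x.1.2 x.2.1.2⟩, congrArg (· + 1) x.2.2⟩) <| by
    constructor
    · rintro ⟨⟨u, hu⟩, ⟨⟨v, p⟩, hp⟩⟩ ⟨⟨u', hu'⟩, ⟨⟨v', p'⟩, hp'⟩⟩ h
      cases h
      rfl
    · rintro ⟨⟨v, p⟩, hp⟩
      cases p with
      | nil => simp at hp
      | cons hu p => exact ⟨⟨⟨_, hu⟩, ⟨⟨v, p⟩, by simpa using hp⟩⟩, rfl⟩

instance walksFromZeroUnique (o : V) : Unique (G.WalksFrom o 0) where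
  default := ⟨⟨o, Walk.nil⟩, rfl⟩
  uniq := by
    rintro ⟨⟨v, p⟩, hp⟩
    cases p with
    | nil => rfl
    | cons => simp at hp

variable [G.LocallyFinite]

theorem finite_walksFrom (o : V) (t : ℕ) : Finite (G.WalksFrom o t) := by
  induction t generalizing o with
  | zero => infer_instance
  | succ t ih =>
    have (u : G.neighborSet o) : Finite (G.WalksFrom u t) := ih u
    exact Finite.of_equiv _ (G.walksFromSuccEquiv o t)

/-- The sum of a function over the neighbours of a vertex. -/
noncomputable def neighborSum (f : V → ℝ) (v : V) : ℝ := ∑ u ∈ G.neighborFinset v, f u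

theorem tsum_walksFrom (o : V) (t : ℕ) (f : V → ℝ) :
    ∑' q : G.WalksFrom o t, f q.1.1 = (G.neighborSum)^[t] f o := by
  induction t generalizing o with
  | zero => rw [tsum_eq_single default (fun b hb => absurd (Unique.eq_default b) hb)]; rfl
  | succ t ih =>
    have (u : G.neighborSet o) : Finite (G.WalksFrom u t) := G.finite_walksFrom u t
    rw [← (G.walksFromSuccEquiv o t).tsum_eq, Summable.tsum_sigma Summable.of_finite,
      Function.iterate_succ_apply', tsum_fintype, neighborSum, neighborFinset]
    calc _ = ∑ u : G.neighborSet o, (G.neighborSum)^[t] f u :=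
          Finset.sum_congr rfl fun u _ => ih u
      _ = _ := (Finset.sum_subtype _ (by simp) _).symm

theorem finite_sphere (hconn : G.Connected) (o : V) (t : ℕ) : {v | G.dist o v = t}.Finite := by
  have := G.finite_walksFrom o t
  refine (Set.finite_range fun q : G.WalksFrom o t => q.1.1).subset fun v hv => ?_
  obtain ⟨p, hp⟩ := hconn.exists_walk_length_eq_dist o v
  exact ⟨⟨⟨v, p⟩, hp.trans hv⟩, rfl⟩

/-- The sphere of radius `t` around `o`. -/
noncomputable def sphere (hconn : G.Connected) (o : V) (t : ℕ) : Finset V :=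
  (G.finite_sphere hconn o t).toFinset

/-- The sum of a function over the sphere of radius `t` around `o`. -/
noncomputable def sphereSum (hconn : G.Connected) (o : V) (f : V → ℝ) (t : ℕ) : ℝ :=
  ∑ v ∈ G.sphere hconn o t, f v

variable {G}

@[simp]
theorem mem_sphere {hconn : G.Connected} {o v : V} {t : ℕ} :
    v ∈ G.sphere hconn o t ↔ G.dist o v = t := by
  simp [sphere]

theorem tsum_paths (hconn : G.Connected) (hacyc : G.IsAcyclic) (o : V) (t : ℕ) (f : V → ℝ) :
    ∑' q : {q : Σ v : V, G.Walk o v // q.2.length = t ∧ q.2.IsPath}, f q.1.1 =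
      G.sphereSum hconn o f t := by
  let e : {q : Σ v : V, G.Walk o v // q.2.length = t ∧ q.2.IsPath} → G.sphere hconn o t :=
    fun q => ⟨q.1.1, by
      rw [mem_sphere, ← hacyc.length_eq_dist_of_isPath q.2.2, q.2.1]⟩
  have he : Function.Bijective e := by
    constructor
    · rintro ⟨⟨v, p⟩, hp, hpp⟩ ⟨⟨w, q⟩, hq, hqp⟩ h
      obtain rfl : v = w := congrArg Subtype.val h
      have := congrArg Subtype.val ((hacyc.subsingleton_path _ _).elim ⟨p, hpp⟩ ⟨q, hqp⟩)
      simp only at this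
      subst this
      rfl
    · rintro ⟨v, hv⟩
      obtain ⟨p, hp, hlen⟩ := hconn.exists_path_of_dist o v
      exact ⟨⟨⟨v, p⟩, hlen.trans (mem_sphere.1 hv), hp⟩, rfl⟩
  rw [sphereSum, ← Finset.tsum_subtype, ← (Equiv.ofBijective e he).tsum_eq]
  rfl

open Classical in
theorem card_filter_parents (hconn : G.Connected) (hacyc : G.IsAcyclic) {o u : V} {k : ℕ}
    (hu : G.dist o u = k + 1) : ((G.neighborFinset u).filter (G.dist o · = k)).card = 1 := by
  rw [Finset.card_eq_one]
  obtain ⟨p, hp⟩ := hconn.exists_walk_length_eq_dist o u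
  have hnil : ¬ p.Nil := by rw [← Walk.length_eq_zero_iff]; omega
  refine ⟨p.penultimate, ?_⟩
  have key : ∀ w, G.Adj w u → G.dist o w = k → w = p.penultimate := by
    intro w hw hd
    obtain ⟨q, hq⟩ := hconn.exists_walk_length_eq_dist o w
    have hlen : (q.concat hw).length = G.dist o u := by simp [hq, hd, hu]
    have := congrArg Subtype.val ((hacyc.subsingleton_path _ _).elim
      ⟨p, p.isPath_of_length_eq_dist hp⟩ ⟨_, Walk.isPath_of_length_eq_dist _ hlen⟩)
    simp only at this
    simp [this]
  have hadj := p.adj_penultimate hnil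
  have h1 : G.dist o p.penultimate ≤ k := by
    have := dist_le p.dropLast
    have h2 : p.dropLast.length + 1 = p.length := by simp; omega
    omega
  have h3 : G.dist o p.penultimate = k := by
    rcases hacyc.dist_eq_dist_add_one_of_adj_of_reachable o hadj (hconn _ _) with h | h <;> omega
  ext w
  simp only [Finset.mem_filter, mem_neighborFinset, Finset.mem_singleton]
  constructor
  · rintro ⟨h, h'⟩
    exact key w h.symm h'
  · rintro rfl
    exact ⟨hadj.symm, h3⟩

/-- `outDegree d (k + 1)` is the number of children of a vertex at distance `k` from the root of
the `d`-regular tree; `outDegree d 0 = 0` by convention. -/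
def outDegree (d : ℕ) : ℕ → ℕ
  | 0 => 0
  | 1 => d
  | _ + 2 => d - 1

open Classical in
theorem card_filter_children (hconn : G.Connected) (hacyc : G.IsAcyclic) {d : ℕ}
    (hreg : G.IsRegularOfDegree d) {o u : V} {k : ℕ} (hu : G.dist o u = k) :
    ((G.neighborFinset u).filter (G.dist o · = k + 1)).card = outDegree d (k + 1) := by
  have hcard := hreg u
  rw [← card_neighborFinset_eq_degree,
    ← Finset.card_filter_add_card_filter_not (s := G.neighborFinset u) (G.dist o · = k + 1)]
    at hcard
  have hnot : ∀ w ∈ G.neighborFinset u, ¬ G.dist o w = k + 1 ↔ G.dist o w + 1 = k := by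
    intro w hw
    rw [mem_neighborFinset] at hw
    rcases hacyc.dist_eq_dist_add_one_of_adj_of_reachable o hw (hconn _ _) with h | h <;> omega
  rw [Finset.filter_congr hnot] at hcard
  cases k with
  | zero => simpa [outDegree] using hcard
  | succ k =>
    simp only [Nat.add_right_cancel_iff] at hcard
    rw [card_filter_parents hconn hacyc hu] at hcard
    simp only [outDegree]
    omega

theorem sphereSum_neighborSum (hconn : G.Connected) (hacyc : G.IsAcyclic) {d : ℕ}
    (hreg : G.IsRegularOfDegree d) (o : V) (f : V → ℝ) (k : ℕ) :
    G.sphereSum hconn o (G.neighborSum f) k =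
      G.sphereSum hconn o f (k + 1) + outDegree d k * G.sphereSum hconn o f (k - 1) := by
  classical
  have swap : ∀ i j : ℕ, ∑ v ∈ G.sphere hconn o i,
      ∑ u ∈ (G.neighborFinset v).filter (G.dist o · = j), f u =
      ∑ u ∈ G.sphere hconn o j, ((G.neighborFinset u).filter (G.dist o · = i)).card * f u := by
    intro i j
    simp_rw [← nsmul_eq_mul, ← Finset.sum_const]
    refine Finset.sum_comm' fun v u => ?_
    simp only [mem_sphere, Finset.mem_filter, mem_neighborFinset, G.adj_comm u v]
    tauto
  have hnot : ∀ v ∈ G.sphere hconn o k, ∀ w ∈ G.neighborFinset v,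
      ¬ G.dist o w = k + 1 ↔ G.dist o w + 1 = k := by
    intro v hv w hw
    rw [mem_neighborFinset] at hw
    rw [mem_sphere] at hv
    rcases hacyc.dist_eq_dist_add_one_of_adj_of_reachable o hw (hconn _ _) with h | h <;> omega
  have hsplit : G.sphereSum hconn o (G.neighborSum f) k =
      ∑ v ∈ G.sphere hconn o k, ∑ u ∈ (G.neighborFinset v).filter (G.dist o · = k + 1), f u +
      ∑ v ∈ G.sphere hconn o k,
        ∑ u ∈ (G.neighborFinset v).filter (G.dist o · + 1 = k), f u := by
    rw [sphereSum, ← Finset.sum_add_distrib]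
    refine Finset.sum_congr rfl fun v hv => ?_
    rw [neighborSum, ← Finset.sum_filter_add_sum_filter_not _ (G.dist o · = k + 1),
      Finset.filter_congr (hnot v hv)]
  rw [hsplit, swap]
  congr 1
  · refine Finset.sum_congr rfl fun u hu => ?_
    rw [card_filter_parents hconn hacyc (mem_sphere.1 hu), Nat.cast_one, one_mul]
  · cases k with
    | zero => simp [outDegree]
    | succ k =>
      simp only [Nat.add_right_cancel_iff, Nat.add_sub_cancel]
      rw [swap, sphereSum, Finset.mul_sum]
      refine Finset.sum_congr rfl fun u hu => ?_
      rw [card_filter_children hconn hacyc hreg (mem_sphere.1 hu)]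

/-- The number of walks of length `t` in the `d`-regular tree from the root to a given vertex at
distance `k`. -/
def treeWalkCount (d : ℕ) : ℕ → ℕ → ℕ
  | 0, k => if k = 0 then 1 else 0
  | t + 1, k => (if k = 0 then 0 else treeWalkCount d t (k - 1)) +
      outDegree d (k + 1) * treeWalkCount d t (k + 1)

theorem treeWalkCount_eq_zero_of_lt {d t k : ℕ} (h : t < k) : treeWalkCount d t k = 0 := by
  induction t generalizing k with
  | zero => simp [treeWalkCount]; omega
  | succ t ih =>
    rw [treeWalkCount, ih (by omega), ih (by omega)]; simp

theorem treeWalkCount_eq_zero_of_odd {d t k : ℕ} (h : Odd (t + k)) : treeWalkCount d t k = 0 := by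
  induction t generalizing k with
  | zero =>
    have : k ≠ 0 := by rintro rfl; simp at h
    simp [treeWalkCount, this]
  | succ t ih =>
    have h1 : treeWalkCount d t (k + 1) = 0 := ih (by rwa [← add_assoc, add_right_comm])
    rw [treeWalkCount, h1, mul_zero, add_zero]
    split_ifs with hk
    · rfl
    · refine ih ?_
      rw [Nat.odd_iff] at h ⊢
      omega

/-- The pairing of the walk counts with a radial function. -/
noncomputable def treeWalkSum (d : ℕ) (w : ℕ → ℝ) (t : ℕ) : ℝ :=
  ∑ k ∈ Finset.range (t + 1), treeWalkCount d t k * w k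

theorem treeWalkSum_zero (d : ℕ) (w : ℕ → ℝ) : treeWalkSum d w 0 = w 0 := by
  simp [treeWalkSum, treeWalkCount]

theorem treeWalkSum_succ (d : ℕ) (w : ℕ → ℝ) (t : ℕ) :
    treeWalkSum d w (t + 1) =
      treeWalkSum d (fun k => w (k + 1) + outDegree d k * w (k - 1)) t := by
  have h1 : ∑ k ∈ Finset.range (t + 2),
      ((if k = 0 then 0 else treeWalkCount d t (k - 1) : ℕ) : ℝ) * w k =
      ∑ k ∈ Finset.range (t + 1), (treeWalkCount d t k : ℝ) * w (k + 1) := by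
    rw [Finset.sum_range_succ']
    simp
  have h2 : ∑ k ∈ Finset.range (t + 2),
      (outDegree d (k + 1) * treeWalkCount d t (k + 1) : ℝ) * w k =
      ∑ k ∈ Finset.range (t + 1), (treeWalkCount d t k : ℝ) * (outDegree d k * w (k - 1)) := by
    have := Finset.sum_range_succ'
      (fun k => (treeWalkCount d t k : ℝ) * (outDegree d k * w (k - 1))) (t + 2)
    simp only [Nat.add_sub_cancel, show outDegree d 0 = 0 from rfl, Nat.cast_zero, zero_mul, mul_zero,
      add_zero] at this
    rw [Finset.sum_range_succ, Finset.sum_range_succ,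
      treeWalkCount_eq_zero_of_lt (show t < t + 2 by omega),
      treeWalkCount_eq_zero_of_lt (show t < t + 1 by omega)] at this
    simp only [Nat.cast_zero, zero_mul, add_zero] at this
    rw [this]
    exact Finset.sum_congr rfl fun k _ => by ring
  simp only [treeWalkSum, mul_add, Finset.sum_add_distrib]
  rw [← h1, ← h2, ← Finset.sum_add_distrib]
  refine Finset.sum_congr rfl fun k _ => ?_
  rw [treeWalkCount]
  push_cast
  ring

theorem iterate_neighborSum (hconn : G.Connected) (hacyc : G.IsAcyclic) {d : ℕ}
    (hreg : G.IsRegularOfDegree d) (o : V) (f : V → ℝ) (t : ℕ) :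
    (G.neighborSum)^[t] f o = treeWalkSum d (G.sphereSum hconn o f) t := by
  induction t generalizing f with
  | zero =>
    have : G.sphere hconn o 0 = {o} := by
      ext v
      simp [hconn.dist_eq_zero_iff, eq_comm]
    simp [treeWalkSum_zero, sphereSum, this]
  | succ t ih =>
    rw [Function.iterate_succ_apply, ih, treeWalkSum_succ]
    congr 1
    ext k
    exact sphereSum_neighborSum hconn hacyc hreg o f k

end WalkSums

section TreeWalkSum

open Filter Topology

variable {d : ℕ}

theorem cast_outDegree_add_two (hd : 1 ≤ d) (k : ℕ) : (outDegree d (k + 2) : ℝ) = d - 1 := by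
  simp [outDegree, Nat.cast_sub hd]

theorem treeWalkSum_mono {w w' : ℕ → ℝ} {t : ℕ} (h : ∀ k, Even (t + k) → w k ≤ w' k) :
    treeWalkSum d w t ≤ treeWalkSum d w' t := by
  refine Finset.sum_le_sum fun k _ => ?_
  rcases Nat.even_or_odd (t + k) with hk | hk
  · exact mul_le_mul_of_nonneg_left (h k hk) (Nat.cast_nonneg _)
  · simp [treeWalkCount_eq_zero_of_odd hk]

theorem treeWalkSum_const_mul (c : ℝ) (w : ℕ → ℝ) (t : ℕ) :
    treeWalkSum d (fun k => c * w k) t = c * treeWalkSum d w t := by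
  simp only [treeWalkSum, Finset.mul_sum, mul_left_comm]

theorem treeWalkSum_sub (w w' : ℕ → ℝ) (t : ℕ) :
    treeWalkSum d (fun k => w k - w' k) t = treeWalkSum d w t - treeWalkSum d w' t := by
  simp only [treeWalkSum, mul_sub, Finset.sum_sub_distrib]

theorem treeWalkSum_nonneg {w : ℕ → ℝ} (hw : ∀ k, 0 ≤ w k) (t : ℕ) : 0 ≤ treeWalkSum d w t :=
  Finset.sum_nonneg fun k _ => mul_nonneg (Nat.cast_nonneg _) (hw k)

theorem treeWalkCount_mul_le_treeWalkSum {w : ℕ → ℝ} (hw : ∀ k, 0 ≤ w k) (t k : ℕ) :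
    treeWalkCount d t k * w k ≤ treeWalkSum d w t := by
  rcases lt_or_ge t k with h | h
  · simpa [treeWalkCount_eq_zero_of_lt h] using treeWalkSum_nonneg hw t
  · exact Finset.single_le_sum (f := fun k => (treeWalkCount d t k : ℝ) * w k)
      (fun k _ => mul_nonneg (Nat.cast_nonneg _) (hw k)) (Finset.mem_range.2 (by omega))

/-- Supersolutions of the radial adjacency operator bound walk sums from above. -/
theorem treeWalkSum_le_of_supersolution {w : ℕ → ℝ} {r : ℝ} (hr : 0 ≤ r)
    (h : ∀ k, w (k + 1) + outDegree d k * w (k - 1) ≤ r * w k) (t : ℕ) :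
    treeWalkSum d w t ≤ r ^ t * w 0 := by
  induction t with
  | zero => simp [treeWalkSum_zero]
  | succ t ih =>
    rw [treeWalkSum_succ]
    calc _ ≤ treeWalkSum d (fun k => r * w k) t := treeWalkSum_mono fun k _ => h k
      _ = r * treeWalkSum d w t := treeWalkSum_const_mul _ _ _
      _ ≤ r * (r ^ t * w 0) := mul_le_mul_of_nonneg_left ih hr
      _ = _ := by ring

/-- Subsolutions of the radial adjacency operator bound walk sums from below. -/
theorem le_treeWalkSum_of_subsolution {w : ℕ → ℝ} {r : ℝ} (hr : 0 ≤ r)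
    (h : ∀ k, r * w k ≤ w (k + 1) + outDegree d k * w (k - 1)) (t : ℕ) :
    r ^ t * w 1 ≤ treeWalkSum d w (t + 1) := by
  induction t with
  | zero => simp [treeWalkSum_succ, treeWalkSum_zero, outDegree]
  | succ t ih =>
    rw [treeWalkSum_succ]
    calc r ^ (t + 1) * w 1 = r * (r ^ t * w 1) := by ring
      _ ≤ r * treeWalkSum d w (t + 1) := mul_le_mul_of_nonneg_left ih hr
      _ = treeWalkSum d (fun k => r * w k) (t + 1) := (treeWalkSum_const_mul _ _ _).symm
      _ ≤ _ := treeWalkSum_mono fun k _ => h k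

/-- A radial supersolution with eigenvalue `x + (d - 1) / x`. -/
noncomputable def superWeight (d : ℕ) (x : ℝ) (k : ℕ) : ℝ :=
  if k = 0 then 2 * ((d : ℝ) - 1) / d else x ^ k + (((d : ℝ) - 1) / x) ^ k

theorem pow_le_superWeight (hd : 2 ≤ d) {x : ℝ} (hx : 0 < x) (k : ℕ) :
    x ^ k ≤ superWeight d x k := by
  have hd' : (2 : ℝ) ≤ d := by exact_mod_cast hd
  rw [superWeight]
  split_ifs with hk
  · rw [hk, pow_zero, le_div_iff₀ (by linarith)]
    linarith
  · have : 0 ≤ (((d : ℝ) - 1) / x) ^ k := pow_nonneg (div_nonneg (by linarith) hx.le) k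
    linarith

theorem treeWalkSum_superWeight_le (hd : 2 ≤ d) {x : ℝ} (hx : 0 < x) (t : ℕ) :
    treeWalkSum d (superWeight d x) t ≤
      (x + ((d : ℝ) - 1) / x) ^ t * superWeight d x 0 := by
  have hd' : (2 : ℝ) ≤ d := by exact_mod_cast hd
  have hy : 0 < ((d : ℝ) - 1) / x := div_pos (by linarith) hx
  have hxy : x * (((d : ℝ) - 1) / x) = (d : ℝ) - 1 := by field_simp
  refine treeWalkSum_le_of_supersolution (by positivity) (fun k => ?_) t
  simp only [superWeight]
  generalize ((d : ℝ) - 1) / x = y at *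
  match k with
  | 0 =>
    have h : 1 ≤ 2 * ((d : ℝ) - 1) / d := by
      rw [le_div_iff₀ (by linarith)]
      linarith
    simp only [outDegree]
    have : (x + y) * 1 ≤ (x + y) * (2 * ((d : ℝ) - 1) / d) := by gcongr
    simpa using this
  | 1 =>
    have h : (d : ℝ) * (2 * ((d : ℝ) - 1) / d) = 2 * ((d : ℝ) - 1) := by
      field_simp
    simp only [outDegree]
    simp only [Nat.reduceAdd, OfNat.ofNat_ne_zero, if_false, tsub_self, if_true, h, one_ne_zero]
    rw [← hxy]
    apply le_of_eq
    ring
  | k + 2 =>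
    rw [cast_outDegree_add_two (by omega), ← hxy]
    simp only [Nat.add_eq_zero_iff, OfNat.ofNat_ne_zero, one_ne_zero, and_false, if_false,
      show k + 2 - 1 = k + 1 by omega]
    apply le_of_eq
    ring

theorem le_treeWalkSum_pow_sub_pow (hd : 1 ≤ d) {x : ℝ} (hx : 0 < x) (hxd : (d : ℝ) - 1 ≤ x ^ 2)
    (t : ℕ) :
    (x + ((d : ℝ) - 1) / x) ^ t * (x - ((d : ℝ) - 1) / x) ≤
      treeWalkSum d (fun k => x ^ k - (((d : ℝ) - 1) / x) ^ k) (t + 1) := by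
  have hd' : (1 : ℝ) ≤ d := by exact_mod_cast hd
  have hy : 0 ≤ ((d : ℝ) - 1) / x := div_nonneg (by linarith) hx.le
  have hyx : ((d : ℝ) - 1) / x ≤ x := by
    rw [div_le_iff₀ hx]
    linarith [sq x]
  have hxy : x * (((d : ℝ) - 1) / x) = (d : ℝ) - 1 := by field_simp
  have := le_treeWalkSum_of_subsolution (d := d)
    (w := fun k => x ^ k - (((d : ℝ) - 1) / x) ^ k) (add_nonneg hx.le hy) (fun k => ?_) t
  · simpa using this
  generalize ((d : ℝ) - 1) / x = y at *
  match k with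
  | 0 => simpa [outDegree] using hyx
  | 1 =>
    simp only [outDegree]
    apply le_of_eq
    norm_num
    ring
  | k + 2 =>
    rw [cast_outDegree_add_two hd, ← hxy]
    simp only [show k + 2 - 1 = k + 1 by omega]
    apply le_of_eq
    ring

open Nat in
/-- A lower bound for walk counts by (scaled) ballot numbers. -/
theorem ballot_le_treeWalkCount (t k j : ℕ) (h : t = k + 2 * j) :
    (d - 1) ^ j * (k + 1) * t ! ≤ treeWalkCount d t k * (j ! * (j + k + 1)!) := by
  induction t generalizing k j with
  | zero =>
    obtain rfl : k = 0 := by omega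
    obtain rfl : j = 0 := by omega
    simp [treeWalkCount]
  | succ t ih =>
    match k, j with
    | 0, 0 => omega
    | 0, j + 1 =>
      have h1 := ih 1 j (by omega)
      have ht : t + 1 = 2 * (j + 1) := by omega
      rw [treeWalkCount, factorial_succ t, factorial_succ j, ht]
      simp only [if_true, outDegree, zero_add]
      calc (d - 1) ^ (j + 1) * 1 * (2 * (j + 1) * t !)
          = (d - 1) * (j + 1) * ((d - 1) ^ j * (1 + 1) * t !) := by ring
        _ ≤ d * (j + 1) * (treeWalkCount d t 1 * (j ! * (j + 1 + 1)!)) := by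
          gcongr
          omega
        _ = _ := by ring_nf
    | k + 1, 0 =>
      have h1 := ih k 0 (by omega)
      have ht : t = k := by omega
      subst ht
      simp only [pow_zero, one_mul, factorial_zero, zero_add] at h1 ⊢
      rw [treeWalkCount, factorial_succ (t + 1)]
      simp only [Nat.add_eq_zero_iff, one_ne_zero, and_false, if_false, Nat.add_sub_cancel]
      rw [factorial_succ t] at h1 ⊢
      calc _ ≤ (t + 2) * (treeWalkCount d t t * ((t + 1) * t !)) := by gcongr
        _ = treeWalkCount d t t * ((t + 1 + 1) * ((t + 1) * t !)) := by ring
        _ ≤ _ := Nat.mul_le_mul_right _ (Nat.le_add_right _ _)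
    | k + 1, j + 1 =>
      have h1 := ih k (j + 1) (by omega)
      have h2 := ih (k + 2) j (by omega)
      have ht : t + 1 = k + 2 * j + 3 := by omega
      rw [treeWalkCount, factorial_succ t, ht, show j + 1 + (k + 1) + 1 = (j + k + 2) + 1 by omega,
        factorial_succ (j + k + 2), factorial_succ j]
      rw [show j + 1 + k + 1 = j + k + 2 by omega, factorial_succ j] at h1
      rw [show j + (k + 2) + 1 = (j + k + 2) + 1 by omega, factorial_succ (j + k + 2)] at h2
      simp only [Nat.add_eq_zero_iff, one_ne_zero, and_false, if_false, Nat.add_sub_cancel,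
        outDegree, show k + 1 + 1 = k + 2 from rfl]
      calc _ = (j + k + 2 + 1) * ((d - 1) ^ (j + 1) * (k + 1) * t !) +
            (d - 1) * (j + 1) * ((d - 1) ^ j * (k + 2 + 1) * t !) := by ring
        _ ≤ (j + k + 2 + 1) * (treeWalkCount d t k * ((j + 1) * j ! * (j + k + 2)!)) +
            (d - 1) * (j + 1) * (treeWalkCount d t (k + 2) *
              (j ! * ((j + k + 2 + 1) * (j + k + 2)!))) := by gcongr
        _ = _ := by ring

open Nat in
theorem four_mul_pow_le_treeWalkCount {n : ℕ} (hn : 0 < n) :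
    (4 * (d - 1)) ^ n ≤ 2 * n * (n + 1) * treeWalkCount d (2 * n) 0 := by
  have h := ballot_le_treeWalkCount (d := d) (2 * n) 0 n (by omega)
  have hc : n.centralBinom * n ! * n ! = (2 * n)! := by
    have := Nat.choose_mul_factorial_mul_factorial (show n ≤ 2 * n by omega)
    rwa [show 2 * n - n = n by omega] at this
  rw [← hc, add_zero, factorial_succ] at h
  have h' : (d - 1) ^ n * n.centralBinom ≤ treeWalkCount d (2 * n) 0 * (n + 1) := by
    refine Nat.le_of_mul_le_mul_right (c := n ! * n !) ?_ (by positivity)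
    calc _ = (d - 1) ^ n * (0 + 1) * (n.centralBinom * n ! * n !) := by ring
      _ ≤ _ := h
      _ = _ := by ring
  calc (4 * (d - 1)) ^ n = (d - 1) ^ n * 4 ^ n := by rw [mul_pow, mul_comm]
    _ ≤ (d - 1) ^ n * (2 * n * n.centralBinom) := by
      gcongr
      exact Nat.four_pow_le_two_mul_self_mul_centralBinom n hn
    _ = 2 * n * ((d - 1) ^ n * n.centralBinom) := by ring
    _ ≤ 2 * n * (treeWalkCount d (2 * n) 0 * (n + 1)) := by gcongr
    _ = _ := by ring

theorem treeWalkCount_zero_le_treeWalkCount_add (t m : ℕ) :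
    treeWalkCount d t 0 ≤ treeWalkCount d (t + m) m := by
  induction m with
  | zero => simp
  | succ m ih =>
    rw [← add_assoc, treeWalkCount]
    simp only [Nat.add_eq_zero_iff, one_ne_zero, and_false, if_false, Nat.add_sub_cancel]
    omega

/-- A nonzero nonnegative radial function has even walk sums growing at least at the spectral
radius of the tree. -/
theorem exists_mul_pow_le_treeWalkSum (hd : 2 ≤ d) {a : ℕ → ℝ} (ha : ∀ k, 0 ≤ a k) {m : ℕ}
    (hm : 0 < a (2 * m)) {μ : ℝ} (hμ : 0 < μ) (hμd : μ < 2 * √((d : ℝ) - 1)) :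
    ∃ c > 0, ∀ᶠ t : ℕ in atTop, c * μ ^ (2 * t) ≤ treeWalkSum d a (2 * t) := by
  have hd' : (2 : ℝ) ≤ d := by exact_mod_cast hd
  have hq : 0 < 4 * ((d : ℝ) - 1) := by linarith
  have hμ2 : μ ^ 2 < 4 * ((d : ℝ) - 1) := by
    calc μ ^ 2 < (2 * √((d : ℝ) - 1)) ^ 2 := by gcongr
      _ = _ := by rw [mul_pow, Real.sq_sqrt (by linarith)]; norm_num
  have hr1 : μ ^ 2 / (4 * ((d : ℝ) - 1)) < 1 := (div_lt_one hq).2 hμ2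
  have hr0 : 0 ≤ μ ^ 2 / (4 * ((d : ℝ) - 1)) := by positivity
  have hlim := tendsto_pow_const_mul_const_pow_of_abs_lt_one 2
    (show |μ ^ 2 / (4 * ((d : ℝ) - 1))| < 1 by rwa [abs_of_nonneg hr0])
  have hev : ∀ᶠ n : ℕ in atTop,
      a (2 * m) / μ ^ (2 * m) * μ ^ (2 * (n + m)) ≤ treeWalkSum d a (2 * (n + m)) := by
    filter_upwards [hlim.eventually (gt_mem_nhds (show (0 : ℝ) < 1 / 4 by norm_num)),
      eventually_ge_atTop 1] with n hn hn1
    have h1 : (4 * ((d : ℝ) - 1)) ^ n ≤ 2 * n * (n + 1) * treeWalkCount d (2 * n) 0 := by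
      have := four_mul_pow_le_treeWalkCount (d := d) (show 0 < n by omega)
      have h := (Nat.cast_le (α := ℝ)).2 this
      push_cast [Nat.cast_sub (show 1 ≤ d by omega)] at h
      exact h
    have hn1' : (1 : ℝ) ≤ n := by exact_mod_cast hn1
    have h2 : μ ^ (2 * n) ≤ treeWalkCount d (2 * n) 0 := by
      rw [div_pow, ← mul_div_assoc, div_lt_iff₀ (by positivity), ← pow_mul] at hn
      have h3 : 4 * (n : ℝ) ^ 2 * μ ^ (2 * n) ≤ 4 * (n : ℝ) ^ 2 * treeWalkCount d (2 * n) 0 := by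
        calc _ ≤ (4 * ((d : ℝ) - 1)) ^ n := by linarith
          _ ≤ _ := h1
          _ ≤ _ := mul_le_mul_of_nonneg_right (by nlinarith) (Nat.cast_nonneg _)
      exact le_of_mul_le_mul_left h3 (by positivity)
    have h4 : (treeWalkCount d (2 * n) 0 : ℝ) ≤ treeWalkCount d (2 * (n + m)) (2 * m) := by
      rw [mul_add]
      exact_mod_cast treeWalkCount_zero_le_treeWalkCount_add _ _
    calc _ = μ ^ (2 * n) * a (2 * m) := by
          rw [mul_add, pow_add]
          field_simp
      _ ≤ treeWalkCount d (2 * (n + m)) (2 * m) * a (2 * m) := by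
          gcongr
          exact h2.trans h4
      _ ≤ _ := treeWalkCount_mul_le_treeWalkSum ha _ _
  refine ⟨a (2 * m) / μ ^ (2 * m), by positivity, ?_⟩
  rw [← eventually_map (m := fun n : ℕ => n + m)
    (P := fun t => a (2 * m) / μ ^ (2 * m) * μ ^ (2 * t) ≤ treeWalkSum d a (2 * t)),
    map_add_atTop_eq_nat] at hev
  exact hev

/-- If the even terms are eventually at most `x ^ k`, the even walk sums are at most of order
`(x + (d - 1) / x) ^ t`. -/
theorem exists_treeWalkSum_le_mul_pow (hd : 2 ≤ d) {a : ℕ → ℝ} {x : ℝ} (hx : 0 < x)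
    (ha : ∀ k, 0 ≤ a k) (hax : ∀ᶠ k : ℕ in atTop, a (2 * k) ≤ x ^ (2 * k)) :
    ∃ C > 0, ∀ t, treeWalkSum d a (2 * t) ≤ C * (x + ((d : ℝ) - 1) / x) ^ (2 * t) := by
  have hd' : (2 : ℝ) ≤ d := by exact_mod_cast hd
  obtain ⟨K, hK⟩ := eventually_atTop.1 hax
  set C : ℝ := 1 + ∑ k ∈ Finset.range K, a (2 * k) / x ^ (2 * k)
  have hnn : ∀ k ∈ Finset.range K, 0 ≤ a (2 * k) / x ^ (2 * k) := fun k _ =>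
    div_nonneg (ha _) (by positivity)
  have hC : 1 ≤ C := le_add_of_nonneg_right (Finset.sum_nonneg hnn)
  have hw0 : 0 < superWeight d x 0 := lt_of_lt_of_le (by simp) (pow_le_superWeight hd hx 0)
  have hpow : ∀ k, a (2 * k) ≤ C * x ^ (2 * k) := by
    intro k
    rcases lt_or_ge k K with h | h
    · rw [← div_le_iff₀ (by positivity)]
      exact (Finset.single_le_sum (f := fun k => a (2 * k) / x ^ (2 * k)) hnn
        (Finset.mem_range.2 h)).trans (by simp [C])
    · exact (hK k h).trans (le_mul_of_one_le_left (by positivity) hC)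
  refine ⟨C * superWeight d x 0, by positivity, fun t => ?_⟩
  calc treeWalkSum d a (2 * t) ≤ treeWalkSum d (fun k => C * superWeight d x k) (2 * t) := by
        refine treeWalkSum_mono fun k hk => ?_
        obtain ⟨l, rfl⟩ : ∃ l, k = 2 * l := by
          rw [Nat.even_iff] at hk
          exact ⟨k / 2, by omega⟩
        exact (hpow l).trans (mul_le_mul_of_nonneg_left (pow_le_superWeight hd hx _) (by linarith))
    _ = C * treeWalkSum d (superWeight d x) (2 * t) := treeWalkSum_const_mul _ _ _
    _ ≤ C * ((x + ((d : ℝ) - 1) / x) ^ (2 * t) * superWeight d x 0) :=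
      mul_le_mul_of_nonneg_left (treeWalkSum_superWeight_le hd hx _) (by linarith)
    _ = _ := by ring

/-- If the even terms are eventually at least `x ^ k` with `x` above the square root of `d - 1`,
the even walk sums are at least of order `(x + (d - 1) / x) ^ t`. -/
theorem exists_mul_pow_le_treeWalkSum_of_sqrt_lt (hd : 2 ≤ d) {a : ℕ → ℝ} {x : ℝ}
    (hx : √((d : ℝ) - 1) < x) (ha : ∀ k, 0 ≤ a k)
    (hax : ∀ᶠ k : ℕ in atTop, x ^ (2 * k) ≤ a (2 * k)) :
    ∃ c > 0, ∀ᶠ t : ℕ in atTop,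
      c * (x + ((d : ℝ) - 1) / x) ^ (2 * t) ≤ treeWalkSum d a (2 * t) := by
  have hd' : (2 : ℝ) ≤ d := by exact_mod_cast hd
  set s := √((d : ℝ) - 1) with hs
  have hs0 : 0 < s := Real.sqrt_pos.2 (by linarith)
  have hss : s ^ 2 = (d : ℝ) - 1 := Real.sq_sqrt (by linarith)
  have hx0 : 0 < x := hs0.trans hx
  set r := x + ((d : ℝ) - 1) / x with hr
  set r' := s + ((d : ℝ) - 1) / s
  have hr' : r' = 2 * s := by
    simp only [r', ← hss]
    field_simp
    norm_num
  have hrr : r' < r := by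
    rw [hr', hr, ← hss, ← sub_pos]
    have : x + s ^ 2 / x - 2 * s = (x - s) ^ 2 / x := by
      field_simp
      ring
    rw [this]
    exact div_pos (pow_pos (sub_pos.2 hx) 2) hx0
  have hr'0 : 0 < r' := by rw [hr']; positivity
  have hr0 : 0 < r := hr'0.trans hrr
  have hyx : ((d : ℝ) - 1) / x < x := by
    rw [div_lt_iff₀ hx0, ← hss, ← sq]
    gcongr
  obtain ⟨K, hK⟩ := eventually_atTop.1 hax
  set D : ℝ := ∑ k ∈ Finset.range K, x ^ (2 * k) / s ^ (2 * k)
  have hnn : ∀ k ∈ Finset.range K, 0 ≤ x ^ (2 * k) / s ^ (2 * k) := fun k _ => by positivity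
  have hD : 0 ≤ D := Finset.sum_nonneg hnn
  have hw0 : 0 < superWeight d s 0 := lt_of_lt_of_le (by simp) (pow_le_superWeight hd hs0 0)
  have hpow : ∀ k, x ^ (2 * k) - (((d : ℝ) - 1) / x) ^ (2 * k) - D * superWeight d s (2 * k) ≤
      a (2 * k) := by
    intro k
    have h1 : 0 ≤ (((d : ℝ) - 1) / x) ^ (2 * k) :=
      pow_nonneg (div_nonneg (by linarith) hx0.le) _
    have h2 : D * s ^ (2 * k) ≤ D * superWeight d s (2 * k) :=
      mul_le_mul_of_nonneg_left (pow_le_superWeight hd hs0 _) hD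
    rcases lt_or_ge k K with h | h
    · have : x ^ (2 * k) ≤ D * s ^ (2 * k) := by
        rw [← div_le_iff₀ (by positivity)]
        exact Finset.single_le_sum (f := fun k => x ^ (2 * k) / s ^ (2 * k)) hnn
          (Finset.mem_range.2 h)
      linarith [ha (2 * k)]
    · have : 0 ≤ D * s ^ (2 * k) := by positivity
      linarith [hK k h]
  set κ := (x - ((d : ℝ) - 1) / x) / r
  have hκ : 0 < κ := div_pos (sub_pos.2 hyx) hr0
  have hmain : ∀ t : ℕ, 1 ≤ t →
      κ * r ^ (2 * t) - D * superWeight d s 0 * r' ^ (2 * t) ≤ treeWalkSum d a (2 * t) := by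
    intro t ht
    have h1 := le_treeWalkSum_pow_sub_pow (show 1 ≤ d by omega) hx0
      (by rw [← hss]; gcongr) (2 * t - 1)
    rw [show 2 * t - 1 + 1 = 2 * t by omega] at h1
    have h2 := mul_le_mul_of_nonneg_left (treeWalkSum_superWeight_le hd hs0 (2 * t)) hD
    have h3 : treeWalkSum d (fun k => x ^ k - (((d : ℝ) - 1) / x) ^ k -
        D * superWeight d s k) (2 * t) ≤ treeWalkSum d a (2 * t) := by
      refine treeWalkSum_mono fun k hk => ?_
      obtain ⟨l, rfl⟩ : ∃ l, k = 2 * l := by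
        rw [Nat.even_iff] at hk
        exact ⟨k / 2, by omega⟩
      exact hpow l
    rw [treeWalkSum_sub, treeWalkSum_const_mul] at h3
    have h4 : r ^ (2 * t) = r ^ (2 * t - 1) * r := by
      rw [← pow_succ, show 2 * t - 1 + 1 = 2 * t by omega]
    have h5 : κ * r ^ (2 * t) = r ^ (2 * t - 1) * (x - ((d : ℝ) - 1) / x) := by
      rw [h4]
      simp only [κ]
      field_simp
    rw [h5]
    linarith
  have hlim : Tendsto (fun t : ℕ => D * superWeight d s 0 * ((r' / r) ^ 2) ^ t) atTop (𝓝 0) := by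
    have h0 : 0 ≤ r' / r := by positivity
    have h1 : (r' / r) ^ 2 < 1 := pow_lt_one₀ h0 ((div_lt_one hr0).2 hrr) two_ne_zero
    simpa using (tendsto_pow_atTop_nhds_zero_of_lt_one (by positivity) h1).const_mul
      (D * superWeight d s 0)
  refine ⟨κ / 2, by positivity, ?_⟩
  filter_upwards [hlim.eventually (gt_mem_nhds (half_pos hκ)), eventually_ge_atTop 1] with t ht ht1
  refine le_trans ?_ (hmain t ht1)
  rw [← pow_mul, div_pow, ← mul_div_assoc, div_lt_iff₀ (by positivity)] at ht
  linarith

end TreeWalkSum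

section RootLimits

open Filter Topology

theorem tendsto_const_rpow_one_div {c : ℝ} (hc : 0 < c) :
    Tendsto (fun t : ℕ => c ^ ((1 : ℝ) / (2 * t))) atTop (𝓝 1) := by
  have h : Tendsto (fun t : ℕ => (1 : ℝ) / (2 * t)) atTop (𝓝 0) :=
    (tendsto_natCast_atTop_atTop.const_mul_atTop two_pos).const_div_atTop 1
  simpa [Function.comp_def] using (Real.continuousAt_const_rpow hc.ne').tendsto.comp h

theorem pow_rpow_one_div {x : ℝ} (hx : 0 ≤ x) {t : ℕ} (ht : t ≠ 0) :
    (x ^ (2 * t)) ^ ((1 : ℝ) / (2 * t)) = x := by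
  have := Real.pow_rpow_inv_natCast hx (show 2 * t ≠ 0 by omega)
  rwa [inv_eq_one_div, Nat.cast_mul, Nat.cast_ofNat] at this

theorem rpow_one_div_pow {x : ℝ} (hx : 0 ≤ x) {t : ℕ} (ht : t ≠ 0) :
    (x ^ ((1 : ℝ) / (2 * t))) ^ (2 * t) = x := by
  have := Real.rpow_inv_natCast_pow hx (show 2 * t ≠ 0 by omega)
  rwa [inv_eq_one_div, Nat.cast_mul, Nat.cast_ofNat] at this

theorem tendsto_rpow_one_div_of_growth {b : ℕ → ℝ} {L : ℝ} (hL : 0 < L) (hb : ∀ t, 0 ≤ b t)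
    (hlow : ∀ μ, 0 < μ → μ < L → ∃ c > 0, ∀ᶠ t : ℕ in atTop, c * μ ^ (2 * t) ≤ b t)
    (hupp : ∀ μ, L < μ → ∃ C > 0, ∀ᶠ t : ℕ in atTop, b t ≤ C * μ ^ (2 * t)) :
    Tendsto (fun t : ℕ => b t ^ ((1 : ℝ) / (2 * t))) atTop (𝓝 L) := by
  have key : ∀ {c μ : ℝ}, 0 < c → 0 ≤ μ →
      Tendsto (fun t : ℕ => (c * μ ^ (2 * t)) ^ ((1 : ℝ) / (2 * t))) atTop (𝓝 μ) := by
    intro c μ hc hμ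
    have h := (tendsto_const_rpow_one_div hc).mul_const μ
    rw [one_mul] at h
    refine h.congr' ?_
    filter_upwards [eventually_ge_atTop 1] with t ht
    rw [Real.mul_rpow hc.le (by positivity), pow_rpow_one_div hμ (by omega)]
  rw [tendsto_order]
  constructor
  · intro l hl
    obtain ⟨μ, hμ, hμL⟩ := exists_between (max_lt hl hL)
    obtain ⟨hlμ, hμ0⟩ := max_lt_iff.1 hμ
    obtain ⟨c, hc, hev⟩ := hlow μ hμ0 hμL
    filter_upwards [hev, (key hc hμ0.le).eventually (lt_mem_nhds hlμ)] with t h1 h2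
    exact h2.trans_le (Real.rpow_le_rpow (by positivity) h1 (by positivity))
  · intro l hl
    obtain ⟨μ, hμ, hμL⟩ := exists_between hl
    obtain ⟨C, hC, hev⟩ := hupp μ hμ
    filter_upwards [hev, (key hC (hL.trans hμ).le).eventually (gt_mem_nhds hμL)] with t h1 h2
    exact (Real.rpow_le_rpow (hb t) h1 (by positivity)).trans_lt h2

/-- The radial form of the cogrowth formula. -/
theorem tendsto_treeWalkSum_rpow {d : ℕ} (hd : 2 ≤ d) {a : ℕ → ℝ} (ha : ∀ k, 0 ≤ a k) {m : ℕ}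
    (hm : 0 < a (2 * m)) {α : ℝ}
    (hα : Tendsto (fun t : ℕ => (a (2 * t)) ^ ((1 : ℝ) / (2 * t))) atTop (𝓝 α)) :
    Tendsto (fun t : ℕ => (treeWalkSum d a (2 * t)) ^ ((1 : ℝ) / (2 * t))) atTop
      (𝓝 (if α ≤ √((d : ℝ) - 1) then 2 * √((d : ℝ) - 1) else α + ((d : ℝ) - 1) / α)) := by
  have hd' : (2 : ℝ) ≤ d := by exact_mod_cast hd
  set s := √((d : ℝ) - 1) with hs
  have hs0 : 0 < s := Real.sqrt_pos.2 (by linarith)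
  have hss : s ^ 2 = (d : ℝ) - 1 := Real.sq_sqrt (by linarith)
  have hcont : ∀ y, 0 < y → ContinuousAt (fun x => x + ((d : ℝ) - 1) / x) y := fun y hy =>
    continuousAt_id.add (continuousAt_const.div continuousAt_id hy.ne')
  have hM0 : 0 < max α s := lt_max_of_lt_right hs0
  have hL : (if α ≤ s then 2 * s else α + ((d : ℝ) - 1) / α) =
      max α s + ((d : ℝ) - 1) / max α s := by
    split_ifs with h
    · rw [max_eq_right h, ← hss]
      field_simp
      norm_num
    · rw [max_eq_left (not_le.1 h).le]
  have hLpos : 0 < max α s + ((d : ℝ) - 1) / max α s :=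
    add_pos hM0 (div_pos (by linarith) hM0)
  refine tendsto_rpow_one_div_of_growth (hL ▸ hLpos) (fun t => treeWalkSum_nonneg ha _) ?_ ?_
  · intro μ hμ hμL
    split_ifs at hμL with h
    · exact exists_mul_pow_le_treeWalkSum hd ha hm hμ hμL
    · rw [not_le] at h
      have hα0 : 0 < α := hs0.trans h
      obtain ⟨x, ⟨hxμ, hxs⟩, hxα⟩ := ((((hcont α hα0).eventually (lt_mem_nhds hμL)).and
        (lt_mem_nhds h)).filter_mono nhdsWithin_le_nhds |>.and
        (self_mem_nhdsWithin (s := Set.Iio α))).exists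
      have hx0 : 0 < x := hs0.trans hxs
      obtain ⟨c, hc, hev⟩ := exists_mul_pow_le_treeWalkSum_of_sqrt_lt hd hxs ha (by
        filter_upwards [hα.eventually (lt_mem_nhds hxα), eventually_ge_atTop 1] with t h1 h2
        calc x ^ (2 * t) ≤ ((a (2 * t)) ^ ((1 : ℝ) / (2 * t))) ^ (2 * t) := by gcongr
          _ = _ := rpow_one_div_pow (ha _) (by omega))
      refine ⟨c, hc, hev.mono fun t ht => le_trans ?_ ht⟩
      gcongr
  · intro μ hμ
    rw [hL] at hμ
    obtain ⟨x, hxμ, hxM⟩ := (((hcont _ hM0).eventually (gt_mem_nhds hμ)).filter_mono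
      nhdsWithin_le_nhds |>.and (self_mem_nhdsWithin (s := Set.Ioi (max α s)))).exists
    have hx0 : 0 < x := hM0.trans hxM
    have hxα : α < x := (le_max_left _ _).trans_lt hxM
    obtain ⟨C, hC, hev⟩ := exists_treeWalkSum_le_mul_pow hd hx0 ha (by
      filter_upwards [hα.eventually (gt_mem_nhds hxα), eventually_ge_atTop 1] with t h1 h2
      calc a (2 * t) = ((a (2 * t)) ^ ((1 : ℝ) / (2 * t))) ^ (2 * t) :=
            (rpow_one_div_pow (ha _) (by omega)).symm
        _ ≤ x ^ (2 * t) := by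
          gcongr
          exact Real.rpow_nonneg (ha _) _)
    have hy : 0 ≤ ((d : ℝ) - 1) / x := div_nonneg (by linarith) hx0.le
    refine ⟨C, hC, Eventually.of_forall fun t => (hev t).trans ?_⟩
    gcongr

end RootLimits

end SimpleGraph


/-- Ordinary-limit version of the extended cogrowth formula, even case: if
`ᾱ = lim_{t→∞} a_{2t}(f)^{1/(2t)}` exists and `f` is not identically zero on vertices at
even distance from `o`, then `lim_{t→∞} b_{2t}(f)^{1/(2t)}` exists and equals `g_d(ᾱ)`. -/
theorem extended_cogrowth_formula_even_limit (d : ℕ) (hd : 3 ≤ d) {V : Type*}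
    (G : SimpleGraph V) [G.LocallyFinite] (hreg : G.IsRegularOfDegree d)
    (hconn : G.Connected) (hacyc : G.IsAcyclic) (o : V)
    (f : V → ℝ) (hf : ∀ v, 0 ≤ f v)
    (hfe : ∃ v : V, Even (G.dist o v) ∧ f v ≠ 0) :
    ∀ a b : ℕ → ℝ,
      (∀ t, a t = ∑' q : {q : Σ v : V, G.Walk o v // q.2.length = t ∧ q.2.IsPath},
          f q.1.1) →
      (∀ t, b t = ∑' q : {q : Σ v : V, G.Walk o v // q.2.length = t}, f q.1.1) →
      ∀ α : ℝ,
        Filter.Tendsto (fun t : ℕ => (a (2 * t)) ^ ((1 : ℝ) / (2 * t))) Filter.atTop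
          (nhds α) →
        Filter.Tendsto (fun t : ℕ => (b (2 * t)) ^ ((1 : ℝ) / (2 * t))) Filter.atTop
          (nhds (if α ≤ Real.sqrt ((d : ℝ) - 1) then 2 * Real.sqrt ((d : ℝ) - 1)
                 else α + ((d : ℝ) - 1) / α)) := by
  intro a b ha hb α hα
  have ha' : a = G.sphereSum hconn o f := by
    ext t
    rw [ha, SimpleGraph.tsum_paths hconn hacyc]
  have hb' : b = SimpleGraph.treeWalkSum d a := by
    ext t
    rw [hb, ha', ← SimpleGraph.iterate_neighborSum hconn hacyc hreg, ← G.tsum_walksFrom]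
  obtain ⟨v, hv, hfv⟩ := hfe
  obtain ⟨m, hm⟩ := hv.two_dvd
  have hpos : 0 < a (2 * m) := by
    rw [ha']
    exact Finset.sum_pos' (fun u _ => hf u)
      ⟨v, SimpleGraph.mem_sphere.2 hm, (hf v).lt_of_ne' hfv⟩
  have hnonneg : ∀ k, 0 ≤ a k := by
    intro k
    rw [ha']
    exact Finset.sum_nonneg fun u _ => hf u
  rw [hb']
  exact SimpleGraph.tendsto_treeWalkSum_rpow (by omega) hnonneg hpos hα
end
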